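/- arXiv:math/0101159 — 4 statements merged into one kernel-verified Lean document; each statement's English description precedes it below -/
import Mathlib

section
/- Let V be a finite-dimensional real vector space equipped with a nondegenerate alternating bilinear form ω and an inner product g, and let G be a group acting linearly on V preserving both ω and g. Let V^G = {x ∈ V : σ·x = x for all σ ∈ G} be the fixed subspace and W = {x ∈ V : ω(x,y) = 0 for all y ∈ V^G} its ω-orthogonal complement. Then: (i) the restriction of ω to V^G is nondegenerate; (ii) V is the internal direct sum of V^G and W; (iii) the restriction of ω to W is nondegenerate; (iv) the only G-fixed vector in W is 0. -/
/-- A positive definite form on a finite-dimensional real space represents every functional. -/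
theorem exists_eq_of_forall_pos
    {V : Type*} [AddCommGroup V] [Module ℝ V] [FiniteDimensional ℝ V]
    (g : V →ₗ[ℝ] V →ₗ[ℝ] ℝ) (hg_pos : ∀ x : V, x ≠ 0 → 0 < g x x) (f : V →ₗ[ℝ] ℝ) :
    ∃ z : V, g z = f := by
  have hinj : Function.Injective g := by
    rw [injective_iff_map_eq_zero]
    intro x hx
    by_contra hne
    have hpos := hg_pos x hne
    simp [hx] at hpos
  exact (LinearMap.injective_iff_surjective_of_finrank_eq_finrank
    (Subspace.dual_finrank_eq (K := ℝ) (V := V)).symm).mp hinj f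

/-- If `x` is fixed and `g`, `ω` are invariant, then the `g`-representative of `ω x` is fixed. -/
theorem fixed_of_represents_fixed
    {V : Type*} [AddCommGroup V] [Module ℝ V] {G : Type*} [Group G] (ρ : Representation ℝ G V)
    (ω g : V →ₗ[ℝ] V →ₗ[ℝ] ℝ) (hg_pos : ∀ x : V, x ≠ 0 → 0 < g x x)
    (hω_inv : ∀ (σ : G) (x y : V), ω (ρ σ x) (ρ σ y) = ω x y)
    (hg_inv : ∀ (σ : G) (x y : V), g (ρ σ x) (ρ σ y) = g x y)
    {x z : V} (hx : ∀ σ : G, ρ σ x = x) (hz : g z = ω x) (σ : G) : ρ σ z = z := by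
  have hrep : ∀ y, g (ρ σ z) y = g z y := by
    intro y
    rw [← ρ.self_inv_apply σ y, hg_inv, hz, ← hω_inv σ x, hx σ]
  by_contra hne
  have hpos := hg_pos _ (sub_ne_zero.mpr hne)
  rw [map_sub g, LinearMap.sub_apply, hrep, sub_self] at hpos
  exact hpos.false

/-- Let `V` be a finite-dimensional real vector space with a nondegenerate
alternating bilinear form `ω` and an inner product `g`, and let a group `G` act linearly on
`V` preserving both.  Let `F = V^G` be the fixed subspace and `W` its `ω`-orthogonal
complement.  Then (i) `ω` is nondegenerate on `V^G`; (ii) `V = V^G ⊕ W`; (iii) `ω` is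
nondegenerate on `W`; (iv) the only `G`-fixed vector in `W` is `0`. -/
theorem symplectic_fixed_space_splitting
    {V : Type*} [AddCommGroup V] [Module ℝ V] [FiniteDimensional ℝ V]
    {G : Type*} [Group G] (ρ : Representation ℝ G V)
    (ω : V →ₗ[ℝ] V →ₗ[ℝ] ℝ)
    (hω_alt : ∀ x : V, ω x x = 0)
    (hω_nondeg : ∀ x : V, (∀ y : V, ω x y = 0) → x = 0)
    (g : V →ₗ[ℝ] V →ₗ[ℝ] ℝ)
    (hg_symm : ∀ x y : V, g x y = g y x)
    (hg_pos : ∀ x : V, x ≠ 0 → 0 < g x x)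
    (hω_inv : ∀ (σ : G) (x y : V), ω (ρ σ x) (ρ σ y) = ω x y)
    (hg_inv : ∀ (σ : G) (x y : V), g (ρ σ x) (ρ σ y) = g x y)
    (F : Submodule ℝ V) (hF : ∀ x : V, x ∈ F ↔ ∀ σ : G, ρ σ x = x)
    (W : Submodule ℝ V) (hW : ∀ x : V, x ∈ W ↔ ∀ y ∈ F, ω x y = 0) :
    (∀ x ∈ F, (∀ y ∈ F, ω x y = 0) → x = 0) ∧
    IsCompl F W ∧
    (∀ x ∈ W, (∀ y ∈ W, ω x y = 0) → x = 0) ∧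
    (∀ x ∈ W, (∀ σ : G, ρ σ x = x) → x = 0) := by
  have hF_nondeg : ∀ x ∈ F, (∀ y ∈ F, ω x y = 0) → x = 0 := by
    intro x hx hxF
    obtain ⟨z, hz⟩ := exists_eq_of_forall_pos g hg_pos (ω x)
    have hzF : z ∈ F := (hF z).mpr
      (fixed_of_represents_fixed ρ ω g hg_pos hω_inv hg_inv ((hF x).mp hx) hz)
    have hz0 : z = 0 := by
      by_contra hne
      have hpos := hg_pos z hne
      rw [hz, hxF z hzF] at hpos
      exact hpos.false
    refine hω_nondeg x fun y ↦ ?_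
    rw [← hz, hz0, map_zero, LinearMap.zero_apply]
  have hdisj : Disjoint F W := Submodule.disjoint_def.mpr fun x hxF hxW ↦
    hF_nondeg x hxF ((hW x).mp hxW)
  have hrefl : LinearMap.BilinForm.IsRefl ω := LinearMap.IsAlt.isRefl hω_alt
  have hW_eq : W = LinearMap.BilinForm.orthogonal ω F := by
    ext x
    rw [hW, LinearMap.BilinForm.mem_orthogonal_iff]
    exact forall₂_congr fun y _ ↦ hrefl.eq_iff
  have hcompl : IsCompl F W := by
    rw [hW_eq] at hdisj ⊢
    exact (LinearMap.BilinForm.isCompl_orthogonal_iff_disjoint hrefl).mpr hdisj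
  refine ⟨hF_nondeg, hcompl, fun x hxW hx ↦ hω_nondeg x fun y ↦ ?_,
    fun x hxW hx ↦ hF_nondeg x ((hF x).mpr hx) ((hW x).mp hxW)⟩
  obtain ⟨a, ha, b, hb, rfl⟩ := Submodule.mem_sup.mp
    (hcompl.sup_eq_top ▸ Submodule.mem_top : y ∈ F ⊔ W)
  rw [map_add, (hW x).mp hxW a ha, hx b hb, add_zero]
end

section
/- Let N ⊆ SL(2,ℂ) be the subgroup of upper-triangular matrices with both diagonal entries equal to 1, and let w₁, w₂ : SL(2,ℂ) → ℂ be the functions w₁(g) = g₁₁ and w₂(g) = g₂₁ (the entries of the first column). Then: (i) a polynomial function f : SL(2,ℂ) → ℂ satisfies f(g·u) = f(g) for all g ∈ SL(2,ℂ) and all u ∈ N if and only if f belongs to the ℂ-subalgebra of functions generated by w₁ and w₂; (ii) w₁ and w₂ are algebraically independent over ℂ, so this invariant algebra is a polynomial ring in two variables. -/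
/-- The first-column entry functions on `SL(2,ℂ)`: `w i (g) = g i 0`. -/
def sl2FirstColumn (i : Fin 2) : Matrix.SpecialLinearGroup (Fin 2) ℂ → ℂ :=
  fun g => (g : Matrix (Fin 2) (Fin 2) ℂ) i 0

/-- A function `SL(2,ℂ) → ℂ` is polynomial if it is given by a polynomial in the four
matrix entries. -/
def IsPolynomialSL2 (f : Matrix.SpecialLinearGroup (Fin 2) ℂ → ℂ) : Prop :=
  ∃ p : MvPolynomial (Fin 2 × Fin 2) ℂ,
    ∀ g : Matrix.SpecialLinearGroup (Fin 2) ℂ,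
      f g = MvPolynomial.eval
        (fun ij => (g : Matrix (Fin 2) (Fin 2) ℂ) ij.1 ij.2) p

/-- Membership in the maximal unipotent subgroup `N` of upper-triangular matrices of
`SL(2,ℂ)` with both diagonal entries `1`. -/
def MemUnipotentSL2 (u : Matrix.SpecialLinearGroup (Fin 2) ℂ) : Prop :=
  (u : Matrix (Fin 2) (Fin 2) ℂ) 0 0 = 1 ∧
  (u : Matrix (Fin 2) (Fin 2) ℂ) 1 1 = 1 ∧
  (u : Matrix (Fin 2) (Fin 2) ℂ) 1 0 = 0

open MvPolynomial in
/-- If every component of `s` becomes polynomial after multiplication by the coordinate `v k`, then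
so does every polynomial in these components, after multiplication by a power of `v k`. -/
lemma exists_pow_mul_eval_eq_eval {σ τ K : Type*} [Field K] (k : τ) (s : (τ → K) → σ → K)
    (hs : ∀ i, ∃ P : MvPolynomial τ K, ∀ v, v k ≠ 0 → v k * s v i = eval v P)
    (p : MvPolynomial σ K) :
    ∃ (n : ℕ) (P : MvPolynomial τ K), ∀ v, v k ≠ 0 → v k ^ n * eval (s v) p = eval v P := by
  induction p using MvPolynomial.induction_on with
  | C a => exact ⟨0, C a, fun v _ => by simp⟩
  | add p q hp hq =>
    obtain ⟨n, P, hP⟩ := hp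
    obtain ⟨m, Q, hQ⟩ := hq
    refine ⟨n + m, X k ^ m * P + X k ^ n * Q, fun v hv => ?_⟩
    simp only [map_add, map_mul, map_pow, eval_X, ← hP v hv, ← hQ v hv]
    ring
  | mul_X p i hp =>
    obtain ⟨n, P, hP⟩ := hp
    obtain ⟨Q, hQ⟩ := hs i
    refine ⟨n + 1, P * Q, fun v hv => ?_⟩
    simp only [map_mul, eval_X, ← hP v hv, ← hQ v hv]
    ring

open MvPolynomial in
/-- Polynomials over an infinite field agreeing wherever `h` does not vanish are equal. -/
lemma MvPolynomial.eq_of_eval_eq_of_ne_zero {τ K : Type*} [Field K] [Infinite K]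
    {h : MvPolynomial τ K} (hh : h ≠ 0) {p q : MvPolynomial τ K}
    (hpq : ∀ v, eval v h ≠ 0 → eval v p = eval v q) : p = q := by
  refine mul_left_cancel₀ hh (MvPolynomial.funext fun v => ?_)
  by_cases hv : eval v h = 0
  · simp [hv]
  · simp [hpq v hv]

open MvPolynomial in
/-- If `P / x₀ ^ n = Q / x₁ ^ m` as rational functions of two variables, then the common value is a
polynomial. -/
lemma MvPolynomial.exists_eq_pow_mul_of_pow_mul_eq {K : Type*} [Field K]
    {n m : ℕ} {P Q : MvPolynomial (Fin 2) K} (h : X 1 ^ m * P = X 0 ^ n * Q) :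
    ∃ R, P = X 0 ^ n * R ∧ Q = X 1 ^ m * R := by
  have hprime : Prime (X 0 : MvPolynomial (Fin 2) K) := MvPolynomial.X_prime
  have hnot : ¬ (X 0 : MvPolynomial (Fin 2) K) ∣ X 1 ^ m := by
    rintro ⟨S, hS⟩
    simpa using congrArg (eval ![0, 1]) hS
  obtain ⟨R, rfl⟩ := hprime.pow_dvd_of_dvd_mul_left n hnot ⟨Q, h⟩
  refine ⟨R, rfl, mul_left_cancel₀ (pow_ne_zero n hprime.ne_zero) ?_⟩
  rw [← h]
  ring

/-- Pointwise evaluation of a polynomial in the first-column functions. -/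
lemma aeval_sl2FirstColumn_apply (p : MvPolynomial (Fin 2) ℂ)
    (g : Matrix.SpecialLinearGroup (Fin 2) ℂ) :
    MvPolynomial.aeval sl2FirstColumn p g =
      MvPolynomial.eval (fun i => sl2FirstColumn i g) p := by
  induction p using MvPolynomial.induction_on with
  | C a => simp
  | add p q hp hq => simp [hp, hq]
  | mul_X p i hp => simp [hp]

/-- The matrix in `SL(2,ℂ)` with first column `v` and upper right entry zero. -/
noncomputable def sl2LowerSection (v : Fin 2 → ℂ) (hv : v 0 ≠ 0) :
    Matrix.SpecialLinearGroup (Fin 2) ℂ :=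
  ⟨!![v 0, 0; v 1, (v 0)⁻¹], by simp [Matrix.det_fin_two, hv]⟩

/-- The upper unitriangular matrix in `SL(2,ℂ)` with upper right entry `t`. -/
def sl2Unipotent (t : ℂ) : Matrix.SpecialLinearGroup (Fin 2) ℂ :=
  ⟨!![1, t; 0, 1], by simp [Matrix.det_fin_two]⟩

lemma coe_mul_sl2Unipotent (g : Matrix.SpecialLinearGroup (Fin 2) ℂ) (t : ℂ) :
    ((g * sl2Unipotent t : Matrix.SpecialLinearGroup (Fin 2) ℂ) : Matrix (Fin 2) (Fin 2) ℂ) =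
      !![g 0 0, g 0 0 * t + g 0 1; g 1 0, g 1 0 * t + g 1 1] := by
  rw [Matrix.SpecialLinearGroup.coe_mul]
  ext i j
  fin_cases i <;> fin_cases j <;> simp [sl2Unipotent, Matrix.mul_apply, Fin.sum_univ_two]

lemma memUnipotentSL2_sl2Unipotent (t : ℂ) : MemUnipotentSL2 (sl2Unipotent t) := by
  simp [MemUnipotentSL2, sl2Unipotent]

lemma sl2FirstColumn_mul_of_memUnipotentSL2 (i : Fin 2)
    (g u : Matrix.SpecialLinearGroup (Fin 2) ℂ) (hu : MemUnipotentSL2 u) :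
    sl2FirstColumn i (g * u) = sl2FirstColumn i g := by
  obtain ⟨h00, -, h10⟩ := hu
  simp [sl2FirstColumn, Matrix.mul_apply, Fin.sum_univ_two, h00, h10]

lemma algebraicIndependent_sl2FirstColumn : AlgebraicIndependent ℂ sl2FirstColumn := by
  rw [algebraicIndependent_iff]
  intro p hp
  refine MvPolynomial.eq_of_eval_eq_of_ne_zero (MvPolynomial.X_ne_zero (0 : Fin 2)) fun v hv => ?_
  rw [MvPolynomial.eval_X] at hv
  have h := congrFun hp (sl2LowerSection v hv)
  rw [aeval_sl2FirstColumn_apply] at h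
  have hcol : (fun i => sl2FirstColumn i (sl2LowerSection v hv)) = v := by
    funext i
    fin_cases i <;> simp [sl2FirstColumn, sl2LowerSection]
  simpa [hcol] using h

lemma adjoin_sl2FirstColumn_eq_range :
    Algebra.adjoin ℂ ({sl2FirstColumn 0, sl2FirstColumn 1} :
      Set (Matrix.SpecialLinearGroup (Fin 2) ℂ → ℂ)) =
      (MvPolynomial.aeval (R := ℂ) sl2FirstColumn).range := by
  rw [← Algebra.adjoin_range_eq_range_aeval]
  congr 1
  ext f
  simp [eq_comm]

open MvPolynomial in
/-- An invariant polynomial function is a polynomial in the first column. -/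
lemma IsPolynomialSL2.exists_eval_sl2FirstColumn
    {f : Matrix.SpecialLinearGroup (Fin 2) ℂ → ℂ} (hf : IsPolynomialSL2 f)
    (hinv : ∀ g u : Matrix.SpecialLinearGroup (Fin 2) ℂ, MemUnipotentSL2 u → f (g * u) = f g) :
    ∃ R : MvPolynomial (Fin 2) ℂ, ∀ g, f g = eval (fun i => sl2FirstColumn i g) R := by
  obtain ⟨p, hp⟩ := hf
  let s₀ : (Fin 2 → ℂ) → Fin 2 × Fin 2 → ℂ :=
    fun v ij => !![v 0, 0; v 1, (v 0)⁻¹] ij.1 ij.2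
  let s₁ : (Fin 2 → ℂ) → Fin 2 × Fin 2 → ℂ :=
    fun v ij => !![v 0, -(v 1)⁻¹; v 1, 0] ij.1 ij.2
  obtain ⟨n, P, hP⟩ := exists_pow_mul_eval_eq_eval 0 s₀ (by
    rintro ⟨i, j⟩
    refine ⟨!![X 0 * X 0, 0; X 0 * X 1, 1] i j, fun v hv => ?_⟩
    fin_cases i <;> fin_cases j <;> simp [s₀, hv]) p
  obtain ⟨m, Q, hQ⟩ := exists_pow_mul_eval_eq_eval 1 s₁ (by
    rintro ⟨i, j⟩
    refine ⟨!![X 1 * X 0, -1; X 1 * X 1, 0] i j, fun v hv => ?_⟩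
    fin_cases i <;> fin_cases j <;> simp [s₁, hv]) p
  have hdet (g : Matrix.SpecialLinearGroup (Fin 2) ℂ) :
      g 0 0 * g 1 1 - g 0 1 * g 1 0 = 1 := by
    rw [← Matrix.det_fin_two, g.det_coe]
  have hf₀ (g : Matrix.SpecialLinearGroup (Fin 2) ℂ) (hg : sl2FirstColumn 0 g ≠ 0) :
      f g = eval (s₀ fun i => sl2FirstColumn i g) p := by
    rw [← hinv g _ (memUnipotentSL2_sl2Unipotent (-g 0 1 / g 0 0)), hp]
    rw [coe_mul_sl2Unipotent]
    congr 2
    have := hdet g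
    simp only [sl2FirstColumn] at hg
    funext ⟨i, j⟩
    fin_cases i <;> fin_cases j <;> simp [s₀, sl2FirstColumn] <;> field_simp
    all_goals first | ring1 | linear_combination this
  have hf₁ (g : Matrix.SpecialLinearGroup (Fin 2) ℂ) (hg : sl2FirstColumn 1 g ≠ 0) :
      f g = eval (s₁ fun i => sl2FirstColumn i g) p := by
    rw [← hinv g _ (memUnipotentSL2_sl2Unipotent (-g 1 1 / g 1 0)), hp]
    rw [coe_mul_sl2Unipotent]
    congr 2
    have := hdet g
    simp only [sl2FirstColumn] at hg
    funext ⟨i, j⟩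
    fin_cases i <;> fin_cases j <;> simp [s₁, sl2FirstColumn] <;> field_simp
    all_goals first | ring1 | linear_combination -this
  have hPQ : X 1 ^ m * P = X 0 ^ n * Q := by
    refine eq_of_eval_eq_of_ne_zero
      (mul_ne_zero (X_ne_zero (0 : Fin 2)) (X_ne_zero (1 : Fin 2))) fun v hv => ?_
    obtain ⟨hv₀, hv₁⟩ : v 0 ≠ 0 ∧ v 1 ≠ 0 := by simpa using hv
    have hcol : (fun i => sl2FirstColumn i (sl2LowerSection v hv₀)) = v := by
      funext i
      fin_cases i <;> simp [sl2FirstColumn, sl2LowerSection]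
    have h₀ := hf₀ (sl2LowerSection v hv₀) (by rwa [congrFun hcol 0])
    have h₁ := hf₁ (sl2LowerSection v hv₀) (by rwa [congrFun hcol 1])
    rw [hcol] at h₀ h₁
    simp only [map_mul, map_pow, eval_X, ← hP v hv₀, ← hQ v hv₁, ← h₀, ← h₁]
    ring
  obtain ⟨R, rfl, rfl⟩ := exists_eq_pow_mul_of_pow_mul_eq hPQ
  refine ⟨R, fun g => ?_⟩
  by_cases hg₀ : sl2FirstColumn 0 g = 0
  · have hg₁ : sl2FirstColumn 1 g ≠ 0 := by
      intro hg₁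
      have := hdet g
      simp only [sl2FirstColumn] at hg₀ hg₁
      simp [hg₀, hg₁] at this
    refine mul_left_cancel₀ (pow_ne_zero m hg₁) ?_
    rw [hf₁ g hg₁]
    exact (hQ (fun i => sl2FirstColumn i g) hg₁).trans (by rw [map_mul, map_pow, eval_X])
  · refine mul_left_cancel₀ (pow_ne_zero n hg₀) ?_
    rw [hf₀ g hg₀]
    exact (hP (fun i => sl2FirstColumn i g) hg₀).trans (by rw [map_mul, map_pow, eval_X])

/-- (i) A polynomial function on `SL(2,ℂ)` is invariant under right
translation by the maximal unipotent subgroup `N` iff it lies in the `ℂ`-subalgebra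
generated by the first-column entries `w₁ = x₁₁` and `w₂ = x₂₁`; (ii) `w₁` and `w₂` are
algebraically independent over `ℂ`, so this invariant algebra is a polynomial ring in two
variables. -/
theorem sl2_unipotent_invariants :
    (∀ f : Matrix.SpecialLinearGroup (Fin 2) ℂ → ℂ, IsPolynomialSL2 f →
      ((∀ (g u : Matrix.SpecialLinearGroup (Fin 2) ℂ), MemUnipotentSL2 u →
          f (g * u) = f g) ↔
        f ∈ Algebra.adjoin ℂ
          ({sl2FirstColumn 0, sl2FirstColumn 1} :
            Set (Matrix.SpecialLinearGroup (Fin 2) ℂ → ℂ)))) ∧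
    AlgebraicIndependent ℂ sl2FirstColumn := by
  refine ⟨fun f hf => ?_, algebraicIndependent_sl2FirstColumn⟩
  rw [adjoin_sl2FirstColumn_eq_range]
  constructor
  · intro hinv
    obtain ⟨R, hR⟩ := hf.exists_eval_sl2FirstColumn hinv
    exact ⟨R, funext fun g => (aeval_sl2FirstColumn_apply R g).trans (hR g).symm⟩
  · rintro ⟨R, rfl⟩ g u hu
    have hcol : (fun i => sl2FirstColumn i (g * u)) = fun i => sl2FirstColumn i g :=
      funext fun i => sl2FirstColumn_mul_of_memUnipotentSL2 i g u hu
    exact (aeval_sl2FirstColumn_apply R (g * u)).trans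
      (hcol ▸ (aeval_sl2FirstColumn_apply R g).symm)
end

section
/- Let N ⊆ SL(3,ℂ) be the subgroup of upper-triangular matrices with all diagonal entries equal to 1. Define functions on SL(3,ℂ) by wᵢ(g) = g_{i1} for i = 1,2,3, and z₁(g) = g₂₁g₃₂ − g₃₁g₂₂, z₂(g) = g₃₁g₁₂ − g₁₁g₃₂, z₃(g) = g₁₁g₂₂ − g₂₁g₁₂ (the signed 2×2 minors extracted from the first two columns). Then a polynomial function f : SL(3,ℂ) → ℂ satisfies f(g·u) = f(g) for all g ∈ SL(3,ℂ) and all u ∈ N if and only if f belongs to the ℂ-subalgebra of functions generated by w₁, w₂, w₃, z₁, z₂, z₃. -/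
/-- The first-column entry functions on `SL(3,ℂ)`: `wᵢ(g) = g_{i1}`. -/
def sl3W (i : Fin 3) : Matrix.SpecialLinearGroup (Fin 3) ℂ → ℂ :=
  fun g => (g : Matrix (Fin 3) (Fin 3) ℂ) i 0

/-- The signed `2 × 2` minors extracted from the first two columns of `g ∈ SL(3,ℂ)`:
`z₁ = g₂₁g₃₂ − g₃₁g₂₂`, `z₂ = g₃₁g₁₂ − g₁₁g₃₂`, `z₃ = g₁₁g₂₂ − g₂₁g₁₂`. -/
def sl3Z : Fin 3 → Matrix.SpecialLinearGroup (Fin 3) ℂ → ℂ :=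
  ![fun g => (g : Matrix (Fin 3) (Fin 3) ℂ) 1 0 * (g : Matrix (Fin 3) (Fin 3) ℂ) 2 1 -
      (g : Matrix (Fin 3) (Fin 3) ℂ) 2 0 * (g : Matrix (Fin 3) (Fin 3) ℂ) 1 1,
    fun g => (g : Matrix (Fin 3) (Fin 3) ℂ) 2 0 * (g : Matrix (Fin 3) (Fin 3) ℂ) 0 1 -
      (g : Matrix (Fin 3) (Fin 3) ℂ) 0 0 * (g : Matrix (Fin 3) (Fin 3) ℂ) 2 1,
    fun g => (g : Matrix (Fin 3) (Fin 3) ℂ) 0 0 * (g : Matrix (Fin 3) (Fin 3) ℂ) 1 1 -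
      (g : Matrix (Fin 3) (Fin 3) ℂ) 1 0 * (g : Matrix (Fin 3) (Fin 3) ℂ) 0 1]

/-- A function `SL(3,ℂ) → ℂ` is polynomial if it is given by a polynomial in the nine
matrix entries. -/
def IsPolynomialSL3 (f : Matrix.SpecialLinearGroup (Fin 3) ℂ → ℂ) : Prop :=
  ∃ p : MvPolynomial (Fin 3 × Fin 3) ℂ,
    ∀ g : Matrix.SpecialLinearGroup (Fin 3) ℂ,
      f g = MvPolynomial.eval
        (fun ij => (g : Matrix (Fin 3) (Fin 3) ℂ) ij.1 ij.2) p

/-- Membership in the maximal unipotent subgroup `N` of upper-triangular matrices of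
`SL(3,ℂ)` with all diagonal entries `1`. -/
def MemUnipotentSL3 (u : Matrix.SpecialLinearGroup (Fin 3) ℂ) : Prop :=
  (u : Matrix (Fin 3) (Fin 3) ℂ) 0 0 = 1 ∧
  (u : Matrix (Fin 3) (Fin 3) ℂ) 1 1 = 1 ∧
  (u : Matrix (Fin 3) (Fin 3) ℂ) 2 2 = 1 ∧
  (u : Matrix (Fin 3) (Fin 3) ℂ) 1 0 = 0 ∧
  (u : Matrix (Fin 3) (Fin 3) ℂ) 2 0 = 0 ∧
  (u : Matrix (Fin 3) (Fin 3) ℂ) 2 1 = 0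

open MvPolynomial Matrix

namespace SL3Unipotent

/-- The six generators, indexed by `Fin 3 ⊕ Fin 3`. -/
def gen : Fin 3 ⊕ Fin 3 → SpecialLinearGroup (Fin 3) ℂ → ℂ := Sum.elim sl3W sl3Z

theorem mem_adjoin_iff (f : SpecialLinearGroup (Fin 3) ℂ → ℂ) :
    f ∈ Algebra.adjoin ℂ (Set.range sl3W ∪ Set.range sl3Z) ↔
      ∃ P : MvPolynomial (Fin 3 ⊕ Fin 3) ℂ, ∀ g, f g = eval (fun s => gen s g) P := by
  have h (P : MvPolynomial (Fin 3 ⊕ Fin 3) ℂ) (g) :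
      aeval gen P g = eval (fun s => gen s g) P := by
    have : (Pi.evalAlgHom ℂ (fun _ => ℂ) g).comp (aeval gen) = aeval (fun s => gen s g) := by
      ext; simp
    simpa [aeval_eq_eval] using DFunLike.congr_fun this P
  rw [← Set.Sum.elim_range, Algebra.adjoin_range_eq_range_aeval, AlgHom.mem_range]
  exact exists_congr fun P => ⟨fun e g => by rw [← e, ← h]; rfl,
    fun e => funext fun g => by rw [e, ← h]; rfl⟩

theorem sl3Z_eq_cross (g : SpecialLinearGroup (Fin 3) ℂ) (i : Fin 3) :
    sl3Z i g = crossProduct (g.1.col 0) (g.1.col 1) i := by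
  fin_cases i <;> simp [sl3Z, cross_apply]

theorem sum_sl3Z_mul (g : SpecialLinearGroup (Fin 3) ℂ) :
    ∑ i, sl3Z i g * g.1 i 2 = 1 := by
  have := g.2
  rw [det_fin_three] at this
  simp only [sl3Z, Fin.sum_univ_three, cons_val]
  linear_combination this

theorem sum_gen_mul (g : SpecialLinearGroup (Fin 3) ℂ) :
    ∑ j, gen (.inl j) g * gen (.inr j) g = 0 := by
  simp [gen, sl3W, sl3Z, Fin.sum_univ_three]
  ring

theorem gen_mul_unipotent (s) (g u : SpecialLinearGroup (Fin 3) ℂ) (hu : MemUnipotentSL3 u) :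
    gen s (g * u) = gen s g := by
  obtain ⟨h0, h1, h2, h3, h4, h5⟩ := hu
  rcases s with i | i
  · simp [gen, sl3W, mul_apply, Fin.sum_univ_three, h0, h3, h4]
  · fin_cases i <;>
      simp [gen, sl3Z, mul_apply, Fin.sum_univ_three, h0, h1, h3, h4, h5] <;> ring

/-- The fibres of the generators are right cosets of the unipotent subgroup. -/
theorem exists_unipotent (g h : SpecialLinearGroup (Fin 3) ℂ) (e : ∀ s, gen s g = gen s h) :
    ∃ u, MemUnipotentSL3 u ∧ g * u = h := by
  have hw (i) : h.1 i 0 = g.1 i 0 := (e (.inl i)).symm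
  have hz (i) : sl3Z i h = sl3Z i g := (e (.inr i)).symm
  have hg := g.2
  have hh := h.2
  have z0 := hz 0
  have z1 := hz 1
  have z2 := hz 2
  rw [det_fin_three] at hg hh
  simp only [sl3Z, cons_val, hw] at z0 z1 z2 hh
  refine ⟨g⁻¹ * h, ?_, by simp⟩
  have h00 : (g⁻¹ * h).1 0 0 = 1 := by
    simp [adjugate_fin_three, mul_apply, Fin.sum_univ_three, hw]
    linear_combination hg
  have h10 : (g⁻¹ * h).1 1 0 = 0 := by
    simp [adjugate_fin_three, mul_apply, Fin.sum_univ_three, hw]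
    ring
  have h20 : (g⁻¹ * h).1 2 0 = 0 := by
    simp [adjugate_fin_three, mul_apply, Fin.sum_univ_three, hw]
    ring
  have h21 : (g⁻¹ * h).1 2 1 = 0 := by
    simp [adjugate_fin_three, mul_apply, Fin.sum_univ_three]
    linear_combination -h.1 0 1 * z0 - h.1 1 1 * z1 - h.1 2 1 * z2
  have h22 : (g⁻¹ * h).1 2 2 = 1 := by
    simp [adjugate_fin_three, mul_apply, Fin.sum_univ_three]
    linear_combination -h.1 0 2 * z0 - h.1 1 2 * z1 - h.1 2 2 * z2 + hh
  have h11 : (g⁻¹ * h).1 1 1 = 1 := by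
    have := (g⁻¹ * h).2
    rw [det_fin_three, h00, h10, h20, h21, h22] at this
    linear_combination this
  exact ⟨h00, h11, h22, h10, h20, h21⟩

/-- The matrix with first column `w`, whose first two columns have minors `z`, built from vectors
`a`, `b` dual to `w`, `z`. -/
def dualFrame (w z a b : Fin 3 → ℂ) : Matrix (Fin 3) (Fin 3) ℂ :=
  (of ![w, crossProduct z a, b])ᵀ

theorem cross_cross_of_dual {w z a : Fin 3 → ℂ} (hwz : w ⬝ᵥ z = 0) (hwa : w ⬝ᵥ a = 1) :
    crossProduct w (crossProduct z a) = z := by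
  rw [cross_cross_eq_smul_sub_smul', dotProduct_comm z w, hwz, hwa]
  simp

theorem exists_gen_eq {w z a b : Fin 3 → ℂ} (hwz : w ⬝ᵥ z = 0) (hwa : w ⬝ᵥ a = 1)
    (hzb : z ⬝ᵥ b = 1) :
    ∃ g : SpecialLinearGroup (Fin 3) ℂ, g.1 = dualFrame w z a b ∧
      ∀ s, gen s g = Sum.elim w z s := by
  have hc := cross_cross_of_dual hwz hwa
  have hdet : (dualFrame w z a b).det = 1 := by
    have h : w ⬝ᵥ crossProduct (crossProduct z a) b = 1 := by
      rw [triple_product_permutation, triple_product_permutation, hc, dotProduct_comm, hzb]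
    rw [dualFrame, det_transpose, ← h, triple_product_eq_det]
    rfl
  obtain ⟨g, hg⟩ : ∃ g : SpecialLinearGroup (Fin 3) ℂ, g.1 = dualFrame w z a b :=
    ⟨⟨_, hdet⟩, rfl⟩
  refine ⟨g, hg, ?_⟩
  rintro (i | i)
  · simp [gen, sl3W, hg, dualFrame]
  · change sl3Z i g = z i
    rw [sl3Z_eq_cross, hg]
    exact congrFun hc i

theorem exists_dual {w : Fin 3 → ℂ} (hw : w ≠ 0) : ∃ a, w ⬝ᵥ a = 1 := by
  obtain ⟨i, hi⟩ := Function.ne_iff.mp hw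
  exact ⟨Pi.single i (w i)⁻¹, by simpa using mul_inv_cancel₀ hi⟩

theorem continuous_gen (s) : Continuous (gen s) := by
  have h (i j) : Continuous fun g : SpecialLinearGroup (Fin 3) ℂ => g.1 i j :=
    (continuous_subtype_val.matrix_elem i j)
  rcases s with i | i
  · exact h i 0
  · fin_cases i
    all_goals
      simp only [gen, sl3Z, Sum.elim_inr]
      exact ((h _ _).mul (h _ _)).sub ((h _ _).mul (h _ _))

theorem continuous_eval_gen (P : MvPolynomial (Fin 3 ⊕ Fin 3) ℂ) :
    Continuous fun g => eval (fun s => gen s g) P :=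
  (continuous_eval P).comp (continuous_pi continuous_gen)

theorem transvection_mul_apply {i k : Fin 3} (hik : i ≠ k) (t : ℂ)
    (g : SpecialLinearGroup (Fin 3) ℂ) (a j : Fin 3) :
    (SpecialLinearGroup.transvection hik t * g).1 a j =
      g.1 a j + if a = i then t * g.1 k j else 0 := by
  change (transvection i k t * g.1) a j = _
  split_ifs with h
  · subst h; simp
  · simp [h]

theorem gen_transvection_inl {i k : Fin 3} (hik : i ≠ k) (t : ℂ)
    (g : SpecialLinearGroup (Fin 3) ℂ) :
    gen (.inl i) (SpecialLinearGroup.transvection hik t * g) =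
      gen (.inl i) g + t * gen (.inl k) g := by
  simp [gen, sl3W, transvection_mul_apply]

theorem gen_transvection_inr {i k : Fin 3} (hik : k ≠ i) (t : ℂ)
    (g : SpecialLinearGroup (Fin 3) ℂ) :
    gen (.inr i) (SpecialLinearGroup.transvection hik t * g) =
      gen (.inr i) g - t * gen (.inr k) g := by
  fin_cases i <;> fin_cases k <;> first
    | exact absurd rfl hik
    | simp [gen, sl3Z, transvection_mul_apply]
      ring

theorem exists_gen_inl_ne_zero (g : SpecialLinearGroup (Fin 3) ℂ) : ∃ k, gen (.inl k) g ≠ 0 := by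
  by_contra! h
  have h0 (i) : g.1 i 0 = 0 := h i
  have := g.2
  rw [det_fin_three] at this
  simp [h0] at this

theorem exists_gen_inr_ne_zero (g : SpecialLinearGroup (Fin 3) ℂ) : ∃ k, gen (.inr k) g ≠ 0 := by
  by_contra! h
  have h0 (i) : sl3Z i g = 0 := h i
  simpa [h0] using sum_sl3Z_mul g

/-- Through every zero of a generator passes a line of transvections leaving the zero locus. -/
theorem exists_transvection (s : Fin 3 ⊕ Fin 3) (g : SpecialLinearGroup (Fin 3) ℂ)
    (hs : gen s g = 0) :
    ∃ (i j : Fin 3) (hij : i ≠ j),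
      ∀ t ≠ 0, gen s (SpecialLinearGroup.transvection hij t * g) ≠ 0 := by
  rcases s with i | i
  · obtain ⟨k, hk⟩ := exists_gen_inl_ne_zero g
    have hik : i ≠ k := by rintro rfl; exact hk hs
    exact ⟨i, k, hik, fun t ht => by simp [gen_transvection_inl, hs, ht, hk]⟩
  · obtain ⟨k, hk⟩ := exists_gen_inr_ne_zero g
    have hik : k ≠ i := by rintro rfl; exact hk hs
    exact ⟨k, i, hik, fun t ht => by simp [gen_transvection_inr, hs, ht, hk]⟩

theorem continuous_transvection_mul {i j : Fin 3} (hij : i ≠ j)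
    (g : SpecialLinearGroup (Fin 3) ℂ) :
    Continuous fun t : ℂ => SpecialLinearGroup.transvection hij t * g := by
  refine Continuous.subtype_mk (f := fun t : ℂ => transvection i j t * g.1) ?_ _
  refine Continuous.mul (continuous_matrix fun a b => ?_) continuous_const
  simp only [transvection, Matrix.add_apply, single_apply]
  split_ifs <;> fun_prop

theorem eq_of_gen_mul_eq (s : Fin 3 ⊕ Fin 3) {f f' : SpecialLinearGroup (Fin 3) ℂ → ℂ}
    (hf : Continuous f) (hf' : Continuous f') (h : ∀ g, gen s g * f g = gen s g * f' g) :
    f = f' := by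
  funext g
  by_cases hs : gen s g = 0
  · obtain ⟨i, j, hij, ht⟩ := exists_transvection s g hs
    have hc := continuous_transvection_mul hij g
    have := Continuous.ext_on (dense_compl_singleton (0 : ℂ)) (hf.comp hc) (hf'.comp hc)
      fun t h0 => mul_left_cancel₀ (ht t h0) (h _)
    simpa using congrFun this 0
  · exact mul_left_cancel₀ hs (h g)

theorem X_dvd_sub_aeval_update {σ : Type*} [DecidableEq σ] (s : σ) (P : MvPolynomial σ ℂ) :
    X s ∣ P - aeval (Function.update X s 0) P := by
  rw [← Ideal.mem_span_singleton, ← Ideal.Quotient.mk_eq_mk_iff_sub_mem]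
  let π := Ideal.Quotient.mkₐ ℂ (Ideal.span {(X s : MvPolynomial σ ℂ)})
  have : π = π.comp (aeval (Function.update X s 0)) := by
    ext j
    by_cases hj : j = s
    · subst hj
      simp [π]
    · simp [π, hj]
  exact DFunLike.congr_fun this P

/-- The quadric `∑ j ≠ i, xⱼ yⱼ`. -/
noncomputable def quadric (i : Fin 3) : MvPolynomial (Fin 3 ⊕ Fin 3) ℂ :=
  ∑ j ∈ {i}ᶜ, X (.inl j) * X (.inr j)

theorem prime_quadric (i : Fin 3) : Prime (quadric i) := by
  let c : Fin 3 →₀ ℂ := Finsupp.equivFunOnFinite.symm fun j => if j = i then 0 else 1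
  have hc : c.support = {i}ᶜ := by ext; simp [c]
  have hq : quadric i = sumSMulXSMulY c := by
    rw [sumSMulXSMulY, Finsupp.linearCombination_apply, Finsupp.sum, hc]
    refine Finset.sum_congr rfl fun j hj => ?_
    have : c j = 1 := by simpa [c] using hj
    simp [this]
  rw [hq, ← irreducible_iff_prime]
  obtain ⟨k, hk⟩ : ∃ k, k ≠ i := exists_ne i
  refine irreducible_sumSMulXSMulY c ?_ fun r hr => ?_
  · rw [hc]
    fin_cases i <;> decide
  · exact isUnit_of_dvd_one (by simpa [c, hk] using hr k)

theorem quadric_dvd (i k : Fin 3) (P : MvPolynomial (Fin 3 ⊕ Fin 3) ℂ)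
    (h : ∀ v, eval v (quadric i) = 0 → v (.inl k) ≠ 0 → v (.inr k) ≠ 0 → eval v P = 0) :
    quadric i ∣ P := by
  have hp := prime_quadric i
  have := (Ideal.span_singleton_prime hp.ne_zero).mpr hp
  have hX (t : Fin 3 ⊕ Fin 3) (v : Fin 3 ⊕ Fin 3 → ℂ) (h0 : eval v (quadric i) = 0)
      (h1 : v t ≠ 0) : ¬ quadric i ∣ X t := by
    rintro ⟨R, hR⟩
    apply h1
    simpa [h0] using congrArg (eval v) hR
  have hdvd : quadric i ∣ P * X (.inl k) * X (.inr k) := by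
    rw [← Ideal.mem_span_singleton,
      ← IsPrime.vanishingIdeal_zeroLocus (K := ℂ) (Ideal.span {quadric i})]
    intro v hv
    have h0 : eval v (quadric i) = 0 := hv _ (Ideal.mem_span_singleton_self _)
    simp only [aeval_eq_eval, map_mul, eval_X]
    by_cases h1 : v (.inl k) = 0
    · simp [h1]
    by_cases h2 : v (.inr k) = 0
    · simp [h2]
    simp [h v h0 h1 h2]
  have h3 := (hp.dvd_or_dvd hdvd).resolve_right
    (hX (.inr k) (Sum.elim 0 1) (by simp [quadric]) (by simp))
  exact (hp.dvd_or_dvd h3).resolve_right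
    (hX (.inl k) (Sum.elim 1 0) (by simp [quadric]) (by simp))

theorem sum_X_mul_X (s : Fin 3 ⊕ Fin 3) :
    ∑ j, X (.inl j) * X (.inr j) =
      X s * X s.swap + quadric (s.elim id id) := by
  rw [Fintype.sum_eq_add_sum_compl (s.elim id id), quadric]
  rcases s with i | i <;> simp [mul_comm]

theorem exists_eq_X_mul_add (s : Fin 3 ⊕ Fin 3) (P : MvPolynomial (Fin 3 ⊕ Fin 3) ℂ)
    (h : ∀ w z : Fin 3 → ℂ, w ≠ 0 → z ≠ 0 → w ⬝ᵥ z = 0 → Sum.elim w z s = 0 →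
      eval (Sum.elim w z) P = 0) :
    ∃ Q R, P = X s * Q + (∑ j, X (.inl j) * X (.inr j)) * R := by
  set i : Fin 3 := s.elim id id with hi
  obtain ⟨k, hk⟩ : ∃ k, k ≠ i := exists_ne i
  have hkl : Sum.inl k ≠ s := by rintro rfl; exact hk rfl
  have hkr : Sum.inr k ≠ s := by rintro rfl; exact hk rfl
  obtain ⟨Q, hQ⟩ := X_dvd_sub_aeval_update s P
  obtain ⟨R, hR⟩ : quadric i ∣ aeval (Function.update X s 0) P := by
    refine quadric_dvd i k _ fun v h0 h1 h2 => ?_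
    have he : eval v (aeval (Function.update X s 0) P) = eval (Function.update v s 0) P := by
      have : (aeval v).comp (aeval (Function.update X s 0)) =
          aeval (R := ℂ) (Function.update v s 0) := by
        ext j
        by_cases hj : j = s
        · subst hj; simp
        · simp [hj]
      simpa [aeval_eq_eval] using DFunLike.congr_fun this P
    set v' := Function.update v s 0 with hv'
    have hvs : v' s = 0 := by simp [hv']
    have hq : eval v' (quadric i) = 0 := by
      rw [← h0, quadric, map_sum, map_sum]
      refine Finset.sum_congr rfl fun j hj => ?_
      have hj' : j ≠ i := by simpa using hj
      have hjl : Sum.inl j ≠ s := by rintro rfl; exact hj' rfl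
      have hjr : Sum.inr j ≠ s := by rintro rfl; exact hj' rfl
      simp [hv', hjl, hjr]
    rw [he, ← Sum.elim_comp_inl_inr v']
    apply h
    · exact fun e => h1 (by simpa [hv', hkl] using congrFun e k)
    · exact fun e => h2 (by simpa [hv', hkr] using congrFun e k)
    · have := congrArg (eval v') (sum_X_mul_X s)
      simpa [← hi, hq, hvs, dotProduct] using this
    · simpa using hvs
  refine ⟨Q - X s.swap * R, R, ?_⟩
  rw [sum_X_mul_X s]
  linear_combination hQ + hR

theorem mem_of_gen_mul_mem (s : Fin 3 ⊕ Fin 3) {f : SpecialLinearGroup (Fin 3) ℂ → ℂ}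
    (hf : Continuous f)
    (h : gen s * f ∈ Algebra.adjoin ℂ (Set.range sl3W ∪ Set.range sl3Z)) :
    f ∈ Algebra.adjoin ℂ (Set.range sl3W ∪ Set.range sl3Z) := by
  rw [mem_adjoin_iff] at h ⊢
  obtain ⟨P, hP⟩ := h
  obtain ⟨Q, R, rfl⟩ := exists_eq_X_mul_add s P fun w z hw hz hwz hs => by
    obtain ⟨a, ha⟩ := exists_dual hw
    obtain ⟨b, hb⟩ := exists_dual hz
    obtain ⟨g, -, hg⟩ := exists_gen_eq hwz ha hb
    rw [← funext hg, ← hP, Pi.mul_apply, hg, hs, zero_mul]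
  refine ⟨Q, congrFun (eq_of_gen_mul_eq s hf (continuous_eval_gen Q) fun g => ?_)⟩
  simpa [sum_gen_mul] using hP g

theorem mem_of_gen_pow_mul_mem (s : Fin 3 ⊕ Fin 3) (n : ℕ)
    {f : SpecialLinearGroup (Fin 3) ℂ → ℂ} (hf : Continuous f)
    (h : gen s ^ n * f ∈ Algebra.adjoin ℂ (Set.range sl3W ∪ Set.range sl3Z)) :
    f ∈ Algebra.adjoin ℂ (Set.range sl3W ∪ Set.range sl3Z) := by
  induction n with
  | zero => simpa using h
  | succ n ih =>
    rw [pow_succ', mul_assoc] at h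
    exact ih (mem_of_gen_mul_mem s (((continuous_gen s).pow n).mul hf) h)

/-- Clearing denominators on the chart `w₀ ≠ 0`, `z₂ ≠ 0`. -/
theorem exists_clear_denominators (p : MvPolynomial (Fin 3 × Fin 3) ℂ) :
    ∃ (n : ℕ) (P : MvPolynomial (Fin 3 ⊕ Fin 3) ℂ), ∀ w z : Fin 3 → ℂ, w 0 ≠ 0 → z 2 ≠ 0 →
      (w 0 * z 2) ^ n * eval (fun ij =>
        dualFrame w z (Pi.single 0 (w 0)⁻¹) (Pi.single 2 (z 2)⁻¹) ij.1 ij.2) p =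
      eval (Sum.elim w z) P := by
  induction p using MvPolynomial.induction_on with
  | C c => exact ⟨0, C c, by simp⟩
  | add p q hp hq =>
    obtain ⟨n, P, hP⟩ := hp
    obtain ⟨m, Q, hQ⟩ := hq
    refine ⟨n + m, (X (.inl 0) * X (.inr 2)) ^ m * P + (X (.inl 0) * X (.inr 2)) ^ n * Q, ?_⟩
    intro w z hw hz
    simp only [map_add, map_mul, map_pow, eval_X, Sum.elim_inl, Sum.elim_inr,
      ← hP w z hw hz, ← hQ w z hw hz]
    ring
  | mul_X p ij hp =>
    obtain ⟨n, P, hP⟩ := hp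
    obtain ⟨Q, hQ⟩ : ∃ Q : MvPolynomial (Fin 3 ⊕ Fin 3) ℂ, ∀ w z : Fin 3 → ℂ,
        w 0 ≠ 0 → z 2 ≠ 0 →
        w 0 * z 2 * dualFrame w z (Pi.single 0 (w 0)⁻¹) (Pi.single 2 (z 2)⁻¹) ij.1 ij.2 =
        eval (Sum.elim w z) Q := by
      let M : Matrix (Fin 3) (Fin 3) (MvPolynomial (Fin 3 ⊕ Fin 3) ℂ) :=
        !![X (.inl 0) * X (.inr 2) * X (.inl 0), 0, 0;
          X (.inl 0) * X (.inr 2) * X (.inl 1), X (.inr 2) * X (.inr 2), 0;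
          X (.inl 0) * X (.inr 2) * X (.inl 2), -(X (.inr 2) * X (.inr 1)), X (.inl 0)]
      refine ⟨M ij.1 ij.2, fun w z hw hz => ?_⟩
      obtain ⟨i, j⟩ := ij
      fin_cases i <;> fin_cases j <;> simp [M, dualFrame, cross_apply] <;> field_simp
    refine ⟨n + 1, P * Q, fun w z hw hz => ?_⟩
    rw [map_mul, map_mul, eval_X, ← hP w z hw hz, ← hQ w z hw hz]
    ring

end SL3Unipotent

open SL3Unipotent in
/-- A polynomial function on `SL(3,ℂ)` is invariant under right
translation by the maximal unipotent subgroup `N` iff it lies in the `ℂ`-subalgebra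
generated by the first-column entries `w₁, w₂, w₃` and the `2 × 2` minors `z₁, z₂, z₃`
of the first two columns. -/
theorem sl3_unipotent_invariants :
    ∀ f : Matrix.SpecialLinearGroup (Fin 3) ℂ → ℂ, IsPolynomialSL3 f →
      ((∀ (g u : Matrix.SpecialLinearGroup (Fin 3) ℂ), MemUnipotentSL3 u →
          f (g * u) = f g) ↔
        f ∈ Algebra.adjoin ℂ (Set.range sl3W ∪ Set.range sl3Z)) := by
  intro f ⟨p, hp⟩
  constructor
  · intro hinv
    have hf : Continuous f := by
      rw [funext hp]
      exact (continuous_eval p).comp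
        (continuous_pi fun ij => continuous_subtype_val.matrix_elem ij.1 ij.2)
    obtain ⟨n, P, hP⟩ := exists_clear_denominators p
    have hpow (s) : Continuous (gen s ^ n) := (continuous_gen s).pow n
    have hc := (hpow (.inr 2)).mul hf
    refine mem_of_gen_pow_mul_mem (.inr 2) n hf
      (mem_of_gen_pow_mul_mem (.inl 0) n hc ((mem_adjoin_iff _).mpr ⟨P, congrFun ?_⟩))
    refine eq_of_gen_mul_eq (.inl 0) ((hpow _).mul hc) (continuous_eval_gen P) (congrFun ?_)
    refine eq_of_gen_mul_eq (.inr 2) ((continuous_gen _).mul ((hpow _).mul hc))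
      ((continuous_gen _).mul (continuous_eval_gen P)) fun g => ?_
    by_cases hw : gen (.inl 0) g = 0
    · simp [hw]
    by_cases hz : gen (.inr 2) g = 0
    · simp [hz]
    obtain ⟨h, hh, hgen⟩ := exists_gen_eq (w := fun i => gen (.inl i) g)
      (z := fun i => gen (.inr i) g) (a := Pi.single 0 (gen (.inl 0) g)⁻¹)
      (b := Pi.single 2 (gen (.inr 2) g)⁻¹) (sum_gen_mul g) (by simp [hw]) (by simp [hz])
    have helim : (fun s => gen s g) =
        Sum.elim (fun i => gen (.inl i) g) (fun i => gen (.inr i) g) := by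
      ext (i | i) <;> rfl
    obtain ⟨u, hu, rfl⟩ := exists_unipotent g h fun s => by rw [hgen, ← helim]
    have key := hP (fun i => gen (.inl i) g) (fun i => gen (.inr i) g) hw hz
    rw [← hh, ← hp, hinv g u hu, ← helim, mul_pow] at key
    simp only [Pi.mul_apply, Pi.pow_apply]
    rw [← key]
    ring
  · intro h g u hu
    obtain ⟨P, hP⟩ := (mem_adjoin_iff f).mp h
    simp only [hP, gen_mul_unipotent _ g u hu]
end

section
/- Define functions on SL(3,ℂ) by wᵢ(g) = g_{i1} for i = 1,2,3, and z₁(g) = g₂₁g₃₂ − g₃₁g₂₂, z₂(g) = g₃₁g₁₂ − g₁₁g₃₂, z₃(g) = g₁₁g₂₂ − g₂₁g₁₂. Let Φ be the ℂ-algebra homomorphism from the polynomial ring ℂ[W₁,W₂,W₃,Z₁,Z₂,Z₃] in six variables to the algebra of functions SL(3,ℂ) → ℂ sending Wᵢ to wᵢ and Zᵢ to zᵢ. Then the kernel of Φ is the principal ideal generated by W₁Z₁ + W₂Z₂ + W₃Z₃. In particular w₁z₁ + w₂z₂ + w₃z₃ = 0 identically on SL(3,ℂ), and this is the only relation among the six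 functions, so the image of Φ is isomorphic to the coordinate ring of the affine quadric {(w,z) ∈ ℂ³ × ℂ³ : Σₖ wₖzₖ = 0}. -/
/-- The `ℂ`-algebra homomorphism `Φ : ℂ[W₁,W₂,W₃,Z₁,Z₂,Z₃] → Map(SL(3,ℂ), ℂ)` sending
`Wᵢ ↦ wᵢ` (variables `0,1,2`) and `Zᵢ ↦ zᵢ` (variables `3,4,5`). -/
noncomputable def sl3Phi :
    MvPolynomial (Fin 6) ℂ →ₐ[ℂ] (Matrix.SpecialLinearGroup (Fin 3) ℂ → ℂ) :=
  MvPolynomial.aeval (Fin.append sl3W sl3Z)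

open MvPolynomial in
/-- Modulo `X₀X₃ + X₁X₄ + X₂X₅`, some power of `X₀` clears the variable `X₃` from any polynomial. -/
lemma exists_X_zero_pow_mul_congr_indep_X_three {R : Type*} [CommRing R]
    (p : MvPolynomial (Fin 6) R) :
    ∃ (N : ℕ) (r : MvPolynomial (Fin 6) R),
      (∀ (x : Fin 6 → R) (c : R), eval (Function.update x 3 c) r = eval x r) ∧
      X 0 * X 3 + X 1 * X 4 + X 2 * X 5 ∣ X 0 ^ N * p - r := by
  induction p using MvPolynomial.induction_on with
  | C a => exact ⟨0, C a, by simp, by simp⟩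
  | add p₁ p₂ h₁ h₂ =>
    obtain ⟨N₁, r₁, hr₁, s₁, hs₁⟩ := h₁
    obtain ⟨N₂, r₂, hr₂, s₂, hs₂⟩ := h₂
    refine ⟨N₁ + N₂, X 0 ^ N₂ * r₁ + X 0 ^ N₁ * r₂, fun x c => ?_,
      X 0 ^ N₂ * s₁ + X 0 ^ N₁ * s₂, ?_⟩
    · simp [hr₁, hr₂]
    · linear_combination X 0 ^ N₂ * hs₁ + X 0 ^ N₁ * hs₂
  | mul_X p i h =>
    obtain ⟨N, r, hr, s, hs⟩ := h
    by_cases hi : i = 3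
    · subst hi
      refine ⟨N + 1, -(X 1 * X 4 + X 2 * X 5) * r, fun x c => ?_, r + X 0 * X 3 * s, ?_⟩
      · simp [hr]
      · linear_combination X 0 * X 3 * hs
    · refine ⟨N, r * X i, fun x c => ?_, s * X i, ?_⟩
      · simp [hr, hi]
      · linear_combination X i * hs

/-- A point `(w, z)` of the quadric `Σ wₖzₖ = 0` with `w₁ ≠ 0` and `z₃ ≠ 0` is attained on
`SL(3,ℂ)`. -/
lemma exists_append_sl3W_sl3Z_eq (x : Fin 6 → ℂ) (h0 : x 0 ≠ 0) (h5 : x 5 ≠ 0)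
    (hx : x 0 * x 3 + x 1 * x 4 + x 2 * x 5 = 0) :
    ∃ g : Matrix.SpecialLinearGroup (Fin 3) ℂ,
      ∀ i, (Fin.append sl3W sl3Z : Fin 6 → _) i g = x i := by
  refine ⟨⟨!![x 0, 0, 0; x 1, x 5 / x 0, 0; x 2, -x 4 / x 0, 1 / x 5], ?_⟩, ?_⟩
  · simp [Matrix.det_fin_three]
    field_simp
  · have h3 : x 1 * (-x 4 / x 0) - x 2 * (x 5 / x 0) = x 3 := by
      field_simp
      linear_combination -hx
    intro i
    fin_cases i
    · rfl
    · rfl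
    · rfl
    · exact h3
    · change x 2 * 0 - x 0 * (-x 4 / x 0) = x 4
      field_simp
      ring
    · change x 0 * (x 5 / x 0) - x 1 * 0 = x 5
      field_simp
      ring

lemma sl3Phi_apply (p : MvPolynomial (Fin 6) ℂ) (g : Matrix.SpecialLinearGroup (Fin 3) ℂ) :
    sl3Phi p g = MvPolynomial.eval (fun i => (Fin.append sl3W sl3Z : Fin 6 → _) i g) p := by
  induction p using MvPolynomial.induction_on with
  | C a => simp [sl3Phi]
  | add p q hp hq => simp [hp, hq]
  | mul_X p i hp =>
    rw [map_mul, Pi.mul_apply, hp, map_mul, MvPolynomial.eval_X]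
    simp [sl3Phi]

lemma sl3W_mul_sl3Z_sum (g : Matrix.SpecialLinearGroup (Fin 3) ℂ) :
    sl3W 0 g * sl3Z 0 g + sl3W 1 g * sl3Z 1 g + sl3W 2 g * sl3Z 2 g = 0 := by
  simp only [sl3W, sl3Z, Matrix.cons_val]
  ring

open MvPolynomial in
/-- A polynomial vanishing at the points of the quadric with `x₀ ≠ 0` and `x₅ ≠ 0` is divisible by
its equation. -/
lemma quadric_dvd_of_eval_eq_zero {K : Type*} [Field K] [Infinite K]
    {p : MvPolynomial (Fin 6) K}
    (hp : ∀ x : Fin 6 → K, x 0 ≠ 0 → x 5 ≠ 0 → x 0 * x 3 + x 1 * x 4 + x 2 * x 5 = 0 →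
      eval x p = 0) :
    X 0 * X 3 + X 1 * X 4 + X 2 * X 5 ∣ p := by
  obtain ⟨N, r, hr, s, hs⟩ := exists_X_zero_pow_mul_congr_indep_X_three p
  have hr0 : r = 0 := by
    have h : X 0 * X 5 * r = 0 := by
      refine MvPolynomial.funext fun x => ?_
      by_cases h0 : x 0 = 0
      · simp [h0]
      by_cases h5 : x 5 = 0
      · simp [h5]
      set y := Function.update x 3 (-(x 1 * x 4 + x 2 * x 5) / x 0) with hy
      have hq : y 0 * y 3 + y 1 * y 4 + y 2 * y 5 = 0 := by
        simp [hy]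
        field_simp
        ring
      have hpy : eval y p = 0 := hp y (by simpa [hy]) (by simpa [hy]) hq
      have hsy := congrArg (eval y) hs
      simp only [map_sub, map_mul, map_add, map_pow, eval_X, hq, hpy] at hsy
      have hry : eval x r = 0 := by
        rw [← hr x (-(x 1 * x 4 + x 2 * x 5) / x 0), ← hy]
        linear_combination -hsy
      simp [hry]
    simpa [X_ne_zero] using h
  have hX : ¬ (X 0 : MvPolynomial (Fin 6) K) ∣ X 0 * X 3 + X 1 * X 4 + X 2 * X 5 := by
    rintro ⟨t, ht⟩
    simpa using congrArg (eval ![0, 1, 0, 0, 1, 0]) ht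
  have hdvd : (X 0 : MvPolynomial (Fin 6) K) ^ N ∣ (X 0 * X 3 + X 1 * X 4 + X 2 * X 5) * s :=
    ⟨p, by rw [← hs, hr0, sub_zero]⟩
  obtain ⟨t, rfl⟩ := X_prime.pow_dvd_of_dvd_mul_left N hX hdvd
  refine ⟨t, mul_left_cancel₀ (pow_ne_zero N (X_ne_zero (0 : Fin 6))) ?_⟩
  linear_combination hs + hr0

/-- The kernel of `Φ` is the principal ideal generated by
`W₁Z₁ + W₂Z₂ + W₃Z₃`.  In particular `w₁z₁ + w₂z₂ + w₃z₃ = 0` identically on `SL(3,ℂ)`,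
and this is the only relation among the six functions, so the image of `Φ` is the
coordinate ring of the affine quadric `{(w,z) ∈ ℂ³ × ℂ³ : Σₖ wₖzₖ = 0}`. -/
theorem sl3_invariants_single_relation :
    RingHom.ker sl3Phi.toRingHom =
      Ideal.span {MvPolynomial.X 0 * MvPolynomial.X 3 +
        MvPolynomial.X 1 * MvPolynomial.X 4 +
        MvPolynomial.X 2 * MvPolynomial.X 5} ∧
    ∀ g : Matrix.SpecialLinearGroup (Fin 3) ℂ,
      sl3W 0 g * sl3Z 0 g + sl3W 1 g * sl3Z 1 g + sl3W 2 g * sl3Z 2 g = 0 := by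
  refine ⟨?_, sl3W_mul_sl3Z_sum⟩
  ext p
  rw [Ideal.mem_span_singleton, RingHom.mem_ker]
  change sl3Phi p = 0 ↔ _
  constructor
  · intro hp
    refine quadric_dvd_of_eval_eq_zero fun x h0 h5 hx => ?_
    obtain ⟨g, hg⟩ := exists_append_sl3W_sl3Z_eq x h0 h5 hx
    rw [← funext hg, ← sl3Phi_apply, hp, Pi.zero_apply]
  · rintro ⟨s, rfl⟩
    funext g
    rw [sl3Phi_apply, map_mul]
    simp only [map_add, map_mul, MvPolynomial.eval_X]
    exact mul_eq_zero_of_left (sl3W_mul_sl3Z_sum g) _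
end
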